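/- Let n be a natural number, R > 0, and k > 0 a real number such that J_n(k·R) = 0. Then ∫_0^R r · J_n(k·r)² dr = (R²/2) · J_{n+1}(k·R)². -/

import Mathlib

open MeasureTheory

/-- The Bessel function of the first kind of order `n`, defined by its power series. -/
noncomputable def besselJ (n : ℕ) (x : ℝ) : ℝ :=
  ∑' q : ℕ, (-1 : ℝ) ^ q / (Nat.factorial q * Nat.factorial (q + n)) * (x / 2) ^ (2 * q + n)

/-- Coefficients of the reduced Bessel series. -/
noncomputable def bc (n q : ℕ) : ℝ := (-1 : ℝ) ^ q / (Nat.factorial q * Nat.factorial (q + n))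

/-- The reduced Bessel series. -/
noncomputable def bG (n : ℕ) (y : ℝ) : ℝ := ∑' q : ℕ, bc n q * y ^ q

lemma bc_abs (n q : ℕ) : |bc n q| ≤ 1 / (Nat.factorial q : ℝ) := by
  unfold bc
  rw [abs_div, abs_pow, abs_neg, abs_one, one_pow]
  have h1 : (0 : ℝ) < Nat.factorial q := by exact_mod_cast Nat.factorial_pos q
  have h2 : (1 : ℝ) ≤ Nat.factorial (q + n) := by exact_mod_cast Nat.factorial_pos (q + n)
  rw [abs_of_nonneg (by positivity)]
  apply one_div_le_one_div_of_le h1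
  nlinarith

lemma bc_summable (n : ℕ) (y : ℝ) : Summable fun q => bc n q * y ^ q := by
  refine Summable.of_norm_bounded (Real.summable_pow_div_factorial |y|) fun q => ?_
  rw [Real.norm_eq_abs, abs_mul, abs_pow]
  have := mul_le_mul_of_nonneg_right (bc_abs n q) (pow_nonneg (abs_nonneg y) q)
  calc _ ≤ _ := this
    _ = _ := by ring

lemma bc_succ (n q : ℕ) : bc n (q + 1) * ((q : ℝ) + 1) = - bc (n + 1) q := by
  unfold bc
  have e : q + 1 + n = q + (n + 1) := by ring
  rw [e, Nat.factorial_succ q]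
  have h1 : (Nat.factorial q : ℝ) ≠ 0 := by exact_mod_cast Nat.factorial_ne_zero q
  have h2 : (Nat.factorial (q + (n + 1)) : ℝ) ≠ 0 := by exact_mod_cast Nat.factorial_ne_zero _
  have h3 : (q : ℝ) + 1 ≠ 0 := by positivity
  push_cast
  field_simp
  ring

lemma bc_down (n q : ℕ) : bc n q = ((q : ℝ) + n + 1) * bc (n + 1) q := by
  unfold bc
  rw [← add_assoc, Nat.factorial_succ (q + n)]
  have h1 : (Nat.factorial q : ℝ) ≠ 0 := by exact_mod_cast Nat.factorial_ne_zero q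
  have h2 : (Nat.factorial (q + n) : ℝ) ≠ 0 := by exact_mod_cast Nat.factorial_ne_zero _
  have h3 : (q : ℝ) + n + 1 ≠ 0 := by positivity
  push_cast
  field_simp

lemma bG_deriv (n : ℕ) (y : ℝ) : HasDerivAt (bG n) (- bG (n + 1) y) y := by
  set r : ℝ := |y| + 1 with hr
  have hr0 : 0 < r := by positivity
  have hu : Summable fun q : ℕ => (q : ℝ) * r ^ (q - 1) / (Nat.factorial q : ℝ) := by
    rw [← summable_nat_add_iff 1]
    refine (Real.summable_pow_div_factorial r).congr fun q => ?_
    rw [Nat.factorial_succ]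
    have h1 : (Nat.factorial q : ℝ) ≠ 0 := by exact_mod_cast Nat.factorial_ne_zero q
    have h3 : (q : ℝ) + 1 ≠ 0 := by positivity
    push_cast
    field_simp
  have hy : y ∈ Metric.ball (0 : ℝ) r := by simp [hr]
  have h := hasDerivAt_tsum_of_isPreconnected (g := fun q z => bc n q * z ^ q)
    (g' := fun q z => bc n q * (q * z ^ (q - 1))) hu Metric.isOpen_ball
    (convex_ball (0 : ℝ) r).isPreconnected
    (fun q z _ => (hasDerivAt_pow q z).const_mul _)
    (fun q z hz => by
      have hz' : |z| ≤ r := by simpa using (Metric.mem_ball.1 hz).le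
      rw [Real.norm_eq_abs, abs_mul, abs_mul, abs_pow, Nat.abs_cast]
      calc |bc n q| * (q * |z| ^ (q - 1)) ≤ 1 / (Nat.factorial q : ℝ) * (q * r ^ (q - 1)) := by
            gcongr
            exact bc_abs n q
        _ = _ := by ring)
    hy (bc_summable n y) hy
  have e : (∑' q : ℕ, bc n q * (q * y ^ (q - 1))) = - bG (n + 1) y := by
    have e1 : ∀ q : ℕ, bc n (q + 1) * (((q + 1 : ℕ) : ℝ) * y ^ (q + 1 - 1))
        = -(bc (n + 1) q * y ^ q) := fun q => by
      rw [← neg_mul, ← bc_succ]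
      push_cast
      ring
    have hs : Summable fun q : ℕ => bc n q * (q * y ^ (q - 1)) := by
      rw [← summable_nat_add_iff 1]
      exact (bc_summable (n + 1) y).neg.congr fun q => (e1 q).symm
    rw [hs.tsum_eq_zero_add]
    simp only [e1, tsum_neg]
    simp [bG]
  rw [e] at h
  exact h

lemma bG_rec (n : ℕ) (y : ℝ) : bG n y = (n + 1) * bG (n + 1) y - y * bG (n + 2) y := by
  have h1 := (bc_summable (n + 1) y).hasSum.mul_left ((n : ℝ) + 1)
  have h2 := (bc_summable (n + 2) y).hasSum.mul_left (-y)
  have h3 : HasSum (fun q : ℕ => (q : ℝ) * bc (n + 1) q * y ^ q) (-y * bG (n + 2) y) := by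
    rw [← hasSum_nat_add_iff' 1]
    simp only [Finset.range_one, Finset.sum_singleton, Nat.cast_zero, zero_mul, sub_zero]
    refine h2.congr_fun ?_ 
    intro q
    have := bc_succ (n + 1) q
    push_cast
    rw [pow_succ]
    linear_combination (y ^ q * y) * this
  have h4 := h1.add h3
  have : bG n y = (n + 1) * bG (n + 1) y + -y * bG (n + 2) y := by
    refine HasSum.tsum_eq ?_
    refine h4.congr_fun ?_
    intro q
    rw [bc_down n q]; ring
  rw [this]; ring

lemma besselJ_eq (n : ℕ) (x : ℝ) : besselJ n x = (x / 2) ^ n * bG n ((x / 2) ^ 2) := by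
  unfold besselJ bG
  rw [← tsum_mul_left]
  refine tsum_congr fun q => ?_
  unfold bc
  rw [pow_add, pow_mul]; ring

lemma besselJ_deriv (n : ℕ) (x : ℝ) :
    ∃ d, HasDerivAt (besselJ n) d x ∧ x * d = n * besselJ n x - x * besselJ (n + 1) x := by
  have ht : HasDerivAt (fun x : ℝ => x / 2) (1 / 2) x := (hasDerivAt_id x).div_const 2
  have h := (ht.pow n).mul ((bG_deriv n ((x / 2) ^ 2)).comp x (ht.pow 2))
  have e : besselJ n = fun x => (x / 2) ^ n * bG n ((x / 2) ^ 2) := funext (besselJ_eq n)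
  refine ⟨_, by rw [e]; exact h, ?_⟩
  rw [besselJ_eq, besselJ_eq]
  rcases n with _ | n
  · simp
    ring_nf
    simp
  · simp
    ring

lemma besselJ_rec (n : ℕ) (x : ℝ) :
    x * besselJ (n + 2) x = 2 * (n + 1) * besselJ (n + 1) x - x * besselJ n x := by
  rw [besselJ_eq, besselJ_eq, besselJ_eq, bG_rec n]
  ring

theorem besselJ_normalization (n : ℕ) (R k : ℝ) (hR : 0 < R) (hk : 0 < k)
    (hkR : besselJ n (k * R) = 0) :
    ∫ r in (0 : ℝ)..R, r * (besselJ n (k * r)) ^ 2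
      = R ^ 2 / 2 * (besselJ (n + 1) (k * R)) ^ 2 := by
  have hF : ∀ x : ℝ, HasDerivAt (fun x => x ^ 2 / 2 * (besselJ n x ^ 2 + besselJ (n + 1) x ^ 2)
      - n * x * (besselJ n x * besselJ (n + 1) x)) (x * besselJ n x ^ 2) x := fun x => by
    obtain ⟨a, ha, ha'⟩ := besselJ_deriv n x
    obtain ⟨b, hb, hb'⟩ := besselJ_deriv (n + 1) x
    have hrec := besselJ_rec n x
    have h := (((hasDerivAt_pow 2 x).div_const 2).mul ((ha.pow 2).add (hb.pow 2))).sub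
      (((hasDerivAt_id x).const_mul (n : ℝ)).mul (ha.mul hb))
    refine h.congr_deriv ?_
    simp only [Pi.add_apply, Pi.pow_apply, Pi.mul_apply, id]
    push_cast at hb' ⊢
    rw [show n + 1 + 1 = n + 2 from rfl, hrec] at hb'
    linear_combination (x * besselJ n x - n * besselJ (n + 1) x) * ha'
      + (x * besselJ (n + 1) x - n * besselJ n x) * hb'
  have hc : Continuous (besselJ n) := continuous_iff_continuousAt.2 fun x => by
    obtain ⟨a, ha, _⟩ := besselJ_deriv n x
    exact ha.continuousAt
  have hI := intervalIntegral.integral_eq_sub_of_hasDerivAt (a := 0) (b := k * R)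
    (fun x _ => hF x) (Continuous.intervalIntegrable (by fun_prop) _ _)
  have hS := intervalIntegral.integral_comp_mul_left (a := 0) (b := R)
    (fun x => x * besselJ n x ^ 2) hk.ne'
  rw [mul_zero, hI, hkR] at hS
  have e : ∀ r : ℝ, r * besselJ n (k * r) ^ 2 = k⁻¹ * (k * r * besselJ n (k * r) ^ 2) := fun r => by
    field_simp
  simp only [e]
  rw [intervalIntegral.integral_const_mul, hS]
  simp only [smul_eq_mul]
  field_simp
  ring
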